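/- For every real ξ ≠ 0 there exists a unique λ₀(ξ) ∈ (0, λ_c(ξ)) satisfying λ₀(ξ)² + Φ(λ₀(ξ), ξ) = 0, i.e. −λ₀(ξ)² = Φ(λ₀(ξ), ξ). -/

import Mathlib

open Real MeasureTheory Set

noncomputable section

/-- The function `r ↦ r W(r)`. -/
def rW (W : ℝ → ℝ) : ℝ → ℝ := fun r => r * W r

/-- The functional `E₁(ξ,W) = ∫_I [ξ² r ρ̄ W² + r ρ̄ |D(rW)|²] dr`. -/
def E1fun (R₁ R₂ : ℝ) (ρ : ℝ → ℝ) (ξ : ℝ) (W : ℝ → ℝ) : ℝ :=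
  ∫ r in R₁..R₂, (ξ ^ 2 * r * ρ r * (W r) ^ 2 + r * ρ r * (deriv (rW W) r) ^ 2)

/-- The functional `E₂(ξ,W)`. -/
def E2fun (R₁ R₂ μ α : ℝ) (ξ : ℝ) (W : ℝ → ℝ) : ℝ :=
  (∫ r in R₁..R₂,
    (r * (2 * ξ ^ 2 + 1) * (deriv W r) ^ 2 + ((ξ ^ 2 - 1) ^ 2 / r) * (W r) ^ 2 +
      r * (deriv (deriv (rW W)) r) ^ 2)) +
  (1 - α / μ * R₁) * (deriv (rW W) R₁) ^ 2

/-- The functional `E₃(ξ,W) = −ξ² ∫_I g r W² Dρ̄ dr`. -/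
def E3fun (R₁ R₂ g : ℝ) (ρ : ℝ → ℝ) (ξ : ℝ) (W : ℝ → ℝ) : ℝ :=
  -(ξ ^ 2) * ∫ r in R₁..R₂, g * r * (W r) ^ 2 * deriv ρ r

/-- The functional `E(s,ξ,W) = μ s E₂(ξ,W) + E₃(ξ,W)`. -/
def Efun (R₁ R₂ μ α g : ℝ) (ρ : ℝ → ℝ) (s ξ : ℝ) (W : ℝ → ℝ) : ℝ :=
  μ * s * E2fun R₁ R₂ μ α ξ W + E3fun R₁ R₂ g ρ ξ W

/-- Admissible profile: `W ∈ C²`, `W(R₁) = W(R₂) = 0` and `DW(R₂) = 0`. -/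
def AdmW (R₁ R₂ : ℝ) (W : ℝ → ℝ) : Prop :=
  ContDiff ℝ 2 W ∧ W R₁ = 0 ∧ W R₂ = 0 ∧ deriv W R₂ = 0

/-- The set of values `E(s,ξ,W)/E₁(ξ,W)` over admissible, not identically zero, `W`. -/
def PhiSet (R₁ R₂ μ α g : ℝ) (ρ : ℝ → ℝ) (s ξ : ℝ) : Set ℝ :=
  {x : ℝ | ∃ W : ℝ → ℝ, AdmW R₁ R₂ W ∧ (∃ r ∈ Icc R₁ R₂, W r ≠ 0) ∧
    x = Efun R₁ R₂ μ α g ρ s ξ W / E1fun R₁ R₂ ρ ξ W}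

/-- `Φ(s,ξ) = inf { E(s,ξ,W)/E₁(ξ,W) : W admissible, W ≢ 0 }`. -/
def Phi (R₁ R₂ μ α g : ℝ) (ρ : ℝ → ℝ) (s ξ : ℝ) : ℝ :=
  sInf (PhiSet R₁ R₂ μ α g ρ s ξ)

/-- `λ_c(ξ) = sup { −E₃(ξ,W) : W admissible, μ E₂(ξ,W) = 1 }`. -/
def lamc (R₁ R₂ μ α g : ℝ) (ρ : ℝ → ℝ) (ξ : ℝ) : ℝ :=
  sSup {x : ℝ | ∃ W : ℝ → ℝ, AdmW R₁ R₂ W ∧ μ * E2fun R₁ R₂ μ α ξ W = 1 ∧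
    x = -E3fun R₁ R₂ g ρ ξ W}

/-- An infimum of affine functions `s ↦ s p - q` with `p ≥ 0` and `q` bounded above, added to
`s ^ 2`, has exactly one zero in `(0, L)`, provided `q ≤ L p` throughout and `q > 0` somewhere. -/
theorem existsUnique_sq_add_sInf_affine_eq_zero (S : Set (ℝ × ℝ)) (C L : ℝ)
    (hp : ∀ z ∈ S, 0 ≤ z.1) (hq : ∀ z ∈ S, z.2 ≤ C) (hL : ∀ z ∈ S, z.2 ≤ L * z.1)
    (hpos : ∃ z ∈ S, 0 < z.2) :
    ∃! s : ℝ, s ∈ Ioo 0 L ∧ s ^ 2 + sInf ((fun z : ℝ × ℝ => s * z.1 - z.2) '' S) = 0 := by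
  obtain ⟨z₀, hz₀, hz₀pos⟩ := hpos
  have hz₀p := hp z₀ hz₀
  have hz₀L := hL z₀ hz₀
  have hLpos : 0 < L := by
    by_contra! h
    nlinarith
  set φ : ℝ → ℝ := fun s => sInf ((fun z : ℝ × ℝ => s * z.1 - z.2) '' S) with hφ
  have hle : ∀ s, 0 < s → ∀ z ∈ S, φ s ≤ s * z.1 - z.2 := by
    intro s hs z hz
    refine csInf_le ⟨-C, ?_⟩ ⟨z, hz, rfl⟩
    rintro _ ⟨w, hw, rfl⟩
    have := mul_nonneg hs.le (hp w hw)
    have := hq w hw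
    simp only
    linarith
  have hge : ∀ s b, (∀ z ∈ S, b ≤ s * z.1 - z.2) → b ≤ φ s := by
    intro s b hb
    refine le_csInf ⟨_, z₀, hz₀, rfl⟩ ?_
    rintro _ ⟨w, hw, rfl⟩
    exact hb w hw
  have hmono : ∀ s t, 0 < s → s ≤ t → φ s ≤ φ t := by
    intro s t hs hst
    refine hge t _ fun z hz => (hle s hs z hz).trans ?_
    have := mul_le_mul_of_nonneg_right hst (hp z hz)
    linarith
  have hconc : ConcaveOn ℝ (Ioi 0) φ := by
    refine ⟨convex_Ioi 0, fun s hs t ht a b ha hb hab => hge _ _ fun z hz => ?_⟩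
    have h1 := mul_le_mul_of_nonneg_left (hle s hs z hz) ha
    have h2 := mul_le_mul_of_nonneg_left (hle t ht z hz) hb
    have h3 : z.2 = (a + b) * z.2 := by rw [hab, one_mul]
    simp only [smul_eq_mul]
    linarith
  have hcont : ContinuousOn φ (Ioi 0) := hconc.continuousOn isOpen_Ioi
  have hφL : 0 ≤ φ L := hge L 0 fun z hz => by linarith [hL z hz]
  obtain ⟨ε, hε0, hεL, hε⟩ : ∃ ε, 0 < ε ∧ ε < L ∧ ε ^ 2 + φ ε < 0 := by
    have hd : 0 < L + z₀.1 + 1 := by linarith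
    set ε := min (L / 2) (z₀.2 / (2 * (L + z₀.1 + 1))) with hεdef
    have h0 : 0 < ε := lt_min (by linarith) (by positivity)
    have h1 : ε ≤ L / 2 := min_le_left _ _
    have h2 : ε * (2 * (L + z₀.1 + 1)) ≤ z₀.2 :=
      (le_div_iff₀ (by positivity)).1 (min_le_right _ _)
    refine ⟨ε, h0, by linarith, ?_⟩
    have h3 := hle ε h0 z₀ hz₀
    nlinarith
  have hcont' : ContinuousOn (fun s => s ^ 2 + φ s) (Icc ε L) :=
    (continuousOn_pow 2).add (hcont.mono fun s hs => lt_of_lt_of_le hε0 hs.1)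
  obtain ⟨s, hs, hs0⟩ := intermediate_value_Ioo hεL.le hcont'
    (show (0 : ℝ) ∈ Ioo (ε ^ 2 + φ ε) (L ^ 2 + φ L) from ⟨hε, by positivity⟩)
  have hinj : ∀ a b, 0 < a → a < b → a ^ 2 + φ a < b ^ 2 + φ b := by
    intro a b ha hab
    have := hmono a b ha hab.le
    nlinarith
  refine ⟨s, ⟨⟨hε0.trans hs.1, hs.2⟩, hs0⟩, ?_⟩
  rintro t ⟨ht, ht0⟩
  change t ^ 2 + φ t = 0 at ht0
  simp only at hs0
  rcases lt_trichotomy t s with h | h | h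
  · linarith [hinj t s ht.1 h]
  · exact h
  · linarith [hinj s t (hε0.trans hs.1) h]

/-- A Poincaré inequality for functions vanishing at the left endpoint. -/
theorem integral_sq_le_integral_deriv_sq {a b : ℝ} (hab : a ≤ b) {W : ℝ → ℝ}
    (hW : ContDiff ℝ 1 W) (ha : W a = 0) :
    ∫ r in a..b, W r ^ 2 ≤ 4 * (b - a) ^ 2 * ∫ r in a..b, deriv W r ^ 2 := by
  have hc : Continuous W := hW.continuous
  have hc' : Continuous (deriv W) := hW.continuous_deriv le_rfl
  have hd : ∀ r, HasDerivAt W (deriv W r) r := fun r =>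
    (hW.differentiable one_ne_zero r).hasDerivAt
  have hF : ∫ r in a..b, (W r ^ 2 + (r - b) * (2 * W r * deriv W r)) = 0 := by
    rw [intervalIntegral.integral_eq_sub_of_hasDerivAt (f := fun r => (r - b) * W r ^ 2)]
    · simp [ha]
    · intro r _
      refine (((hasDerivAt_id r).sub_const b).mul ((hd r).pow 2)).congr_deriv ?_
      simp
    · exact Continuous.intervalIntegrable (by fun_prop) _ _
  have hlow : ∫ r in a..b, (1 / 2 * W r ^ 2 - 2 * (b - a) ^ 2 * deriv W r ^ 2) ≤
      ∫ r in a..b, (W r ^ 2 + (r - b) * (2 * W r * deriv W r)) := by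
    refine intervalIntegral.integral_mono_on hab
      (Continuous.intervalIntegrable (by fun_prop) _ _)
      (Continuous.intervalIntegrable (by fun_prop) _ _) fun r hr => ?_
    have h1 : (b - r) ^ 2 ≤ (b - a) ^ 2 := by
      have := hr.1
      have := hr.2
      gcongr
    nlinarith [sq_nonneg (W r - 2 * (b - r) * deriv W r),
      mul_le_mul_of_nonneg_right h1 (sq_nonneg (deriv W r))]
  rw [intervalIntegral.integral_sub (Continuous.intervalIntegrable (by fun_prop) _ _)
    (Continuous.intervalIntegrable (by fun_prop) _ _), intervalIntegral.integral_const_mul,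
    intervalIntegral.integral_const_mul, hF] at hlow
  linarith

theorem contDiff_rW {W : ℝ → ℝ} (hW : ContDiff ℝ 2 W) : ContDiff ℝ 2 (rW W) :=
  contDiff_id.mul hW

theorem continuous_deriv_rW {W : ℝ → ℝ} (hW : ContDiff ℝ 2 W) : Continuous (deriv (rW W)) :=
  (contDiff_rW hW).continuous_deriv (by norm_num)

theorem continuous_deriv_deriv_rW {W : ℝ → ℝ} (hW : ContDiff ℝ 2 W) :
    Continuous (deriv (deriv (rW W))) := by
  have h : ContDiff ℝ (1 + 1) (rW W) := by
    rw [one_add_one_eq_two]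
    exact contDiff_rW hW
  exact ((contDiff_succ_iff_deriv.1 h).2.2).continuous_deriv le_rfl

theorem AdmW.const_smul {R₁ R₂ : ℝ} {W : ℝ → ℝ} (hW : AdmW R₁ R₂ W) (c : ℝ) :
    AdmW R₁ R₂ (fun r => c * W r) := by
  obtain ⟨h, h1, h2, h3⟩ := hW
  exact ⟨contDiff_const.mul h, by simp [h1], by simp [h2], by simp [h3]⟩

theorem E2fun_const_mul (R₁ R₂ μ α ξ c : ℝ) (W : ℝ → ℝ) :
    E2fun R₁ R₂ μ α ξ (fun r => c * W r) = c ^ 2 * E2fun R₁ R₂ μ α ξ W := by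
  have h1 : deriv (fun r => c * W r) = fun r => c * deriv W r := by
    funext r
    exact deriv_const_mul_field c
  have h2 : deriv (rW fun r => c * W r) = fun r => c * deriv (rW W) r := by
    funext r
    rw [← deriv_const_mul_field c]
    congr 1
    funext x
    simp only [rW]
    ring
  have h3 : deriv (deriv (rW fun r => c * W r)) = fun r => c * deriv (deriv (rW W)) r := by
    rw [h2]
    funext r
    exact deriv_const_mul_field c
  unfold E2fun
  rw [h3, h2, h1, mul_add, ← intervalIntegral.integral_const_mul]
  congr 1
  · congr 1
    funext r
    ring
  · ring

theorem E3fun_const_mul (R₁ R₂ g ξ c : ℝ) (ρ W : ℝ → ℝ) :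
    E3fun R₁ R₂ g ρ ξ (fun r => c * W r) = c ^ 2 * E3fun R₁ R₂ g ρ ξ W := by
  unfold E3fun
  rw [mul_left_comm, ← intervalIntegral.integral_const_mul (c ^ 2)]
  congr 2
  funext r
  ring

theorem E1fun_pos {R₁ R₂ ξ : ℝ} {ρ W : ℝ → ℝ} (hR₁ : 0 < R₁) (hR₁₂ : R₁ < R₂)
    (hρ : Continuous ρ) (hρpos : ∀ r ∈ Icc R₁ R₂, 0 < ρ r) (hξ : ξ ≠ 0)
    (hW : ContDiff ℝ 2 W) (hne : ∃ r ∈ Icc R₁ R₂, W r ≠ 0) : 0 < E1fun R₁ R₂ ρ ξ W := by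
  have hc := hW.continuous
  have hc' := continuous_deriv_rW hW
  refine intervalIntegral.integral_pos hR₁₂ (Continuous.continuousOn (by fun_prop)) ?_ ?_
  · intro r hr
    have := hρpos r (Ioc_subset_Icc_self hr)
    have := hR₁.trans hr.1
    positivity
  · obtain ⟨r, hr, hr0⟩ := hne
    refine ⟨r, hr, ?_⟩
    have := hρpos r hr
    have := hR₁.trans_le hr.1
    positivity

/-- The elastic part of `E₂` controls the Dirichlet energy. -/
theorem integral_deriv_sq_le_E2fun {R₁ R₂ μ α ξ : ℝ} {W : ℝ → ℝ} (hR₁ : 0 < R₁)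
    (hR₁₂ : R₁ < R₂) (hα : 0 ≤ 1 - α * R₁ / μ) (hW : ContDiff ℝ 2 W) :
    R₁ * ∫ r in R₁..R₂, deriv W r ^ 2 ≤ E2fun R₁ R₂ μ α ξ W := by
  have hc := hW.continuous
  have hc1 : Continuous (deriv W) := hW.continuous_deriv (by norm_num)
  have hc2 := continuous_deriv_deriv_rW hW
  have hb : 0 ≤ (1 - α / μ * R₁) * (deriv (rW W) R₁) ^ 2 := by
    rw [div_mul_eq_mul_div]
    exact mul_nonneg hα (sq_nonneg _)
  unfold E2fun
  refine le_add_of_le_of_nonneg ?_ hb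
  rw [← intervalIntegral.integral_const_mul]
  refine intervalIntegral.integral_mono_on hR₁₂.le
    (Continuous.intervalIntegrable (by fun_prop) _ _)
    (ContinuousOn.intervalIntegrable ?_) fun r hr => ?_
  · rw [uIcc_of_le hR₁₂.le]
    refine ContinuousOn.add (ContinuousOn.add (Continuous.continuousOn (by fun_prop)) ?_)
      (Continuous.continuousOn (by fun_prop))
    exact (continuousOn_const.div continuousOn_id fun r hr => (hR₁.trans_le hr.1).ne').mul
      (Continuous.continuousOn (by fun_prop))
  · have hr0 := hR₁.trans_le hr.1
    have h1 : 0 ≤ (ξ ^ 2 - 1) ^ 2 / r * W r ^ 2 := by positivity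
    have h2 : 0 ≤ r * deriv (deriv (rW W)) r ^ 2 := by positivity
    have h3 : R₁ * deriv W r ^ 2 ≤ r * (2 * ξ ^ 2 + 1) * deriv W r ^ 2 := by
      have := hr.1
      gcongr
      nlinarith [sq_nonneg ξ]
    linarith

theorem integral_sq_pos {a b : ℝ} (hab : a < b) {W : ℝ → ℝ} (hW : Continuous W)
    (hne : ∃ r ∈ Icc a b, W r ≠ 0) : 0 < ∫ r in a..b, W r ^ 2 := by
  obtain ⟨r, hr, hr0⟩ := hne
  exact intervalIntegral.integral_pos hab (Continuous.continuousOn (by fun_prop))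
    (fun x _ => sq_nonneg _) ⟨r, hr, by positivity⟩

theorem E2fun_pos {R₁ R₂ μ α ξ : ℝ} {W : ℝ → ℝ} (hR₁ : 0 < R₁) (hR₁₂ : R₁ < R₂)
    (hα : 0 ≤ 1 - α * R₁ / μ) (hW : AdmW R₁ R₂ W) (hne : ∃ r ∈ Icc R₁ R₂, W r ≠ 0) :
    0 < E2fun R₁ R₂ μ α ξ W := by
  have h1 := integral_deriv_sq_le_E2fun (ξ := ξ) hR₁ hR₁₂ hα hW.1
  have h2 := integral_sq_le_integral_deriv_sq hR₁₂.le (hW.1.of_le (by norm_num)) hW.2.1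
  have h3 := integral_sq_pos hR₁₂ hW.1.continuous hne
  have h4 : 0 < ∫ r in R₁..R₂, deriv W r ^ 2 :=
    pos_of_mul_pos_right (h3.trans_le h2) (by positivity)
  nlinarith

/-- `-E₃` is dominated by the weighted `L²` norm. -/
theorem neg_E3fun_le {R₁ R₂ g ξ M : ℝ} {ρ W : ℝ → ℝ} (hR₁ : 0 < R₁) (hR₁₂ : R₁ < R₂)
    (hg : 0 < g) (hρ' : Continuous (deriv ρ)) (hM : ∀ r ∈ Icc R₁ R₂, deriv ρ r ≤ M)
    (hW : Continuous W) :
    -E3fun R₁ R₂ g ρ ξ W ≤ ξ ^ 2 * (g * M * ∫ r in R₁..R₂, r * W r ^ 2) := by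
  unfold E3fun
  rw [neg_mul, neg_neg]
  refine mul_le_mul_of_nonneg_left ?_ (sq_nonneg ξ)
  rw [← intervalIntegral.integral_const_mul]
  refine intervalIntegral.integral_mono_on hR₁₂.le
    (Continuous.intervalIntegrable (by fun_prop) _ _)
    (Continuous.intervalIntegrable (by fun_prop) _ _) fun r hr => ?_
  have hr0 := hR₁.trans_le hr.1
  have := mul_le_mul_of_nonneg_left (hM r hr) (show 0 ≤ g * r * W r ^ 2 by positivity)
  linarith

theorem exists_neg_E3fun_le_E1fun {R₁ R₂ g ξ : ℝ} {ρ : ℝ → ℝ} (hR₁ : 0 < R₁)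
    (hR₁₂ : R₁ < R₂) (hg : 0 < g) (hρ : Continuous ρ) (hρ' : Continuous (deriv ρ))
    (hρpos : ∀ r ∈ Icc R₁ R₂, 0 < ρ r) :
    ∃ C, ∀ W, ContDiff ℝ 2 W → -E3fun R₁ R₂ g ρ ξ W ≤ C * E1fun R₁ R₂ ρ ξ W := by
  obtain ⟨M, hM⟩ := (isCompact_Icc (a := R₁) (b := R₂)).bddAbove_image hρ'.abs.continuousOn
  obtain ⟨x, hx, hmin⟩ := (isCompact_Icc (a := R₁) (b := R₂)).exists_isMinOn
    ⟨R₁, left_mem_Icc.2 hR₁₂.le⟩ hρ.continuousOn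
  have hM' : ∀ r ∈ Icc R₁ R₂, |deriv ρ r| ≤ M := fun r hr => hM ⟨r, hr, rfl⟩
  have hM0 : 0 ≤ M := (abs_nonneg _).trans (hM' x hx)
  have hm := hρpos x hx
  refine ⟨g * M / ρ x, fun W hW => ?_⟩
  have hc := hW.continuous
  have hc' := continuous_deriv_rW hW
  refine (neg_E3fun_le hR₁ hR₁₂ hg hρ'
    (fun r hr => (le_abs_self _).trans (hM' r hr)) hc).trans ?_
  have key : ξ ^ 2 * ρ x * ∫ r in R₁..R₂, r * W r ^ 2 ≤ E1fun R₁ R₂ ρ ξ W := by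
    unfold E1fun
    rw [← intervalIntegral.integral_const_mul]
    refine intervalIntegral.integral_mono_on hR₁₂.le
      (Continuous.intervalIntegrable (by fun_prop) _ _)
      (Continuous.intervalIntegrable (by fun_prop) _ _) fun r hr => ?_
    have hr0 := hR₁.trans_le hr.1
    have h1 : 0 ≤ r * ρ r * deriv (rW W) r ^ 2 := by
      have := hρpos r hr
      positivity
    have h2 := mul_le_mul_of_nonneg_left (isMinOn_iff.1 hmin r hr)
      (show 0 ≤ ξ ^ 2 * r * W r ^ 2 by positivity)
    linarith
  calc ξ ^ 2 * (g * M * ∫ r in R₁..R₂, r * W r ^ 2)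
      = g * M / ρ x * (ξ ^ 2 * ρ x * ∫ r in R₁..R₂, r * W r ^ 2) := by
        field_simp
    _ ≤ _ := mul_le_mul_of_nonneg_left key (by positivity)

theorem exists_neg_E3fun_le_E2fun {R₁ R₂ μ α g ξ : ℝ} {ρ : ℝ → ℝ} (hR₁ : 0 < R₁)
    (hR₁₂ : R₁ < R₂) (hg : 0 < g) (hα : 0 ≤ 1 - α * R₁ / μ) (hρ' : Continuous (deriv ρ)) :
    ∃ C, ∀ W, AdmW R₁ R₂ W → -E3fun R₁ R₂ g ρ ξ W ≤ C * E2fun R₁ R₂ μ α ξ W := by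
  obtain ⟨M, hM⟩ := (isCompact_Icc (a := R₁) (b := R₂)).bddAbove_image hρ'.abs.continuousOn
  have hM' : ∀ r ∈ Icc R₁ R₂, |deriv ρ r| ≤ M := fun r hr => hM ⟨r, hr, rfl⟩
  have hM0 : 0 ≤ M := (abs_nonneg _).trans (hM' R₁ (left_mem_Icc.2 hR₁₂.le))
  have hR₂ := hR₁.trans hR₁₂
  refine ⟨ξ ^ 2 * g * M * R₂ * (4 * (R₂ - R₁) ^ 2) / R₁, fun W hW => ?_⟩
  have hc := hW.1.continuous
  have h1 : ∫ r in R₁..R₂, r * W r ^ 2 ≤ R₂ * ∫ r in R₁..R₂, W r ^ 2 := by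
    rw [← intervalIntegral.integral_const_mul]
    refine intervalIntegral.integral_mono_on hR₁₂.le
      (Continuous.intervalIntegrable (by fun_prop) _ _)
      (Continuous.intervalIntegrable (by fun_prop) _ _) fun r hr => ?_
    exact mul_le_mul_of_nonneg_right hr.2 (sq_nonneg _)
  have h2 := integral_sq_le_integral_deriv_sq hR₁₂.le (hW.1.of_le (by norm_num)) hW.2.1
  have h3 := integral_deriv_sq_le_E2fun (ξ := ξ) hR₁ hR₁₂ hα hW.1
  calc -E3fun R₁ R₂ g ρ ξ W ≤ ξ ^ 2 * (g * M * ∫ r in R₁..R₂, r * W r ^ 2) :=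
        neg_E3fun_le hR₁ hR₁₂ hg hρ' (fun r hr => (le_abs_self _).trans (hM' r hr)) hc
    _ ≤ ξ ^ 2 * (g * M * (R₂ * (4 * (R₂ - R₁) ^ 2 * ∫ r in R₁..R₂, deriv W r ^ 2))) := by
        gcongr
        exact h1.trans (by gcongr)
    _ = ξ ^ 2 * g * M * R₂ * (4 * (R₂ - R₁) ^ 2) / R₁ *
        (R₁ * ∫ r in R₁..R₂, deriv W r ^ 2) := by
        field_simp
    _ ≤ _ := by gcongr

theorem neg_E3fun_le_lamc_mul {R₁ R₂ μ α g ξ : ℝ} {ρ W : ℝ → ℝ} (hR₁ : 0 < R₁)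
    (hR₁₂ : R₁ < R₂) (hμ : 0 < μ) (hg : 0 < g) (hα : 0 ≤ 1 - α * R₁ / μ)
    (hρ' : Continuous (deriv ρ)) (hW : AdmW R₁ R₂ W) (hne : ∃ r ∈ Icc R₁ R₂, W r ≠ 0) :
    -E3fun R₁ R₂ g ρ ξ W ≤ lamc R₁ R₂ μ α g ρ ξ * (μ * E2fun R₁ R₂ μ α ξ W) := by
  have hpos : 0 < μ * E2fun R₁ R₂ μ α ξ W := mul_pos hμ (E2fun_pos hR₁ hR₁₂ hα hW hne)
  set N := μ * E2fun R₁ R₂ μ α ξ W with hN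
  obtain ⟨C, hC⟩ := exists_neg_E3fun_le_E2fun (ξ := ξ) hR₁ hR₁₂ hg hα hρ'
  have hsq : (√N)⁻¹ ^ 2 = N⁻¹ := by rw [inv_pow, Real.sq_sqrt hpos.le]
  have hmem : -E3fun R₁ R₂ g ρ ξ (fun r => (√N)⁻¹ * W r) ≤ lamc R₁ R₂ μ α g ρ ξ := by
    refine le_csSup ⟨C / μ, ?_⟩ ⟨_, hW.const_smul _, ?_, rfl⟩
    · rintro _ ⟨V, hV, hV1, rfl⟩
      rw [le_div_iff₀ hμ]
      calc -E3fun R₁ R₂ g ρ ξ V * μ ≤ C * E2fun R₁ R₂ μ α ξ V * μ := by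
            gcongr
            exact hC V hV
        _ = C := by rw [mul_assoc, mul_comm _ μ, hV1, mul_one]
    · rw [E2fun_const_mul, hsq, mul_left_comm, ← hN, inv_mul_cancel₀ hpos.ne']
  rw [E3fun_const_mul, hsq, ← mul_neg, inv_mul_eq_div, div_le_iff₀ hpos] at hmem
  exact hmem

theorem exists_admW_neg_E3fun_pos {R₁ R₂ g ξ : ℝ} {ρ : ℝ → ℝ} (hR₁ : 0 < R₁)
    (hR₁₂ : R₁ < R₂) (hg : 0 < g) (hξ : ξ ≠ 0) (hρ' : Continuous (deriv ρ))
    (hinst : ∃ rs ∈ Ioo R₁ R₂, 0 < deriv ρ rs) :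
    ∃ W, AdmW R₁ R₂ W ∧ (∃ r ∈ Icc R₁ R₂, W r ≠ 0) ∧ 0 < -E3fun R₁ R₂ g ρ ξ W := by
  obtain ⟨rs, hrs, hpos⟩ := hinst
  have hopen : IsOpen (Ioo R₁ R₂ ∩ {r | 0 < deriv ρ r}) :=
    isOpen_Ioo.inter (isOpen_lt continuous_const hρ')
  obtain ⟨ε, hε, hball⟩ := Metric.isOpen_iff.1 hopen rs ⟨hrs, hpos⟩
  let f : ContDiffBump rs := ⟨ε / 2, ε, by positivity, by linarith⟩
  have hzero : ∀ r, r ∉ Ioo R₁ R₂ ∩ {r | 0 < deriv ρ r} → f r = 0 := fun r hr =>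
    f.zero_of_le_dist (not_lt.1 fun h => hr (hball h))
  have hfrs : f rs = 1 := f.one_of_mem_closedBall (Metric.mem_closedBall_self (by positivity))
  have hf2 : f R₂ = 0 := hzero _ fun h => lt_irrefl _ h.1.2
  have hc : Continuous f := f.continuous
  refine ⟨f, ⟨f.contDiff, hzero _ fun h => lt_irrefl _ h.1.1, hf2, ?_⟩,
    ⟨rs, Ioo_subset_Icc_self hrs, by simp [hfrs]⟩, ?_⟩
  · refine IsLocalMin.deriv_eq_zero (Filter.Eventually.of_forall fun r => ?_)
    rw [hf2]
    exact f.nonneg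
  · unfold E3fun
    rw [neg_mul, neg_neg]
    refine mul_pos (by positivity) (intervalIntegral.integral_pos hR₁₂
      (Continuous.continuousOn (by fun_prop)) (fun r hr => ?_)
      ⟨rs, Ioo_subset_Icc_self hrs, ?_⟩)
    · by_cases h : r ∈ Ioo R₁ R₂ ∩ {r | 0 < deriv ρ r}
      · have h1 : 0 < deriv ρ r := h.2
        have h2 := hR₁.trans hr.1
        positivity
      · simp [hzero r h]
    · rw [hfrs]
      have := hR₁.trans hrs.1
      positivity

theorem statement13 (R₁ R₂ μ α g : ℝ) (hR₁ : 0 < R₁) (hR₁₂ : R₁ < R₂) (hμ : 0 < μ)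
    (hg : 0 < g) (hα : 0 ≤ 1 - α * R₁ / μ) (ρ : ℝ → ℝ) (hρ : ContDiff ℝ (⊤ : ℕ∞) ρ)
    (hρpos : ∀ r ∈ Icc R₁ R₂, 0 < ρ r)
    (hinst : ∃ rs ∈ Ioo R₁ R₂, 0 < deriv ρ rs) :
    ∀ ξ : ℝ, ξ ≠ 0 →
      ∃! lam : ℝ, lam ∈ Ioo 0 (lamc R₁ R₂ μ α g ρ ξ) ∧
        lam ^ 2 + Phi R₁ R₂ μ α g ρ lam ξ = 0 := by
  intro ξ hξ
  have hρ' : Continuous (deriv ρ) := hρ.continuous_deriv (by simp)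
  obtain ⟨C, hC⟩ :=
    exists_neg_E3fun_le_E1fun (ξ := ξ) hR₁ hR₁₂ hg hρ.continuous hρ' hρpos
  let Adm : Set (ℝ → ℝ) := {W | AdmW R₁ R₂ W ∧ ∃ r ∈ Icc R₁ R₂, W r ≠ 0}
  let ratios : (ℝ → ℝ) → ℝ × ℝ := fun W =>
    (μ * E2fun R₁ R₂ μ α ξ W / E1fun R₁ R₂ ρ ξ W, -E3fun R₁ R₂ g ρ ξ W / E1fun R₁ R₂ ρ ξ W)
  have hE1 : ∀ W ∈ Adm, 0 < E1fun R₁ R₂ ρ ξ W := fun W hW =>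
    E1fun_pos hR₁ hR₁₂ hρ.continuous hρpos hξ hW.1.1 hW.2
  have hPhi : ∀ s, Phi R₁ R₂ μ α g ρ s ξ =
      sInf ((fun z : ℝ × ℝ => s * z.1 - z.2) '' (ratios '' Adm)) := by
    intro s
    unfold Phi PhiSet
    congr 1
    rw [image_image]
    ext x
    constructor
    · rintro ⟨W, hW, hne, rfl⟩
      refine ⟨W, ⟨hW, hne⟩, ?_⟩
      simp only [ratios, Efun]
      ring
    · rintro ⟨W, ⟨hW, hne⟩, rfl⟩
      refine ⟨W, hW, hne, ?_⟩
      simp only [ratios, Efun]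
      ring
  simp only [hPhi]
  refine existsUnique_sq_add_sInf_affine_eq_zero _ C _ ?_ ?_ ?_ ?_
  · rintro _ ⟨W, hW, rfl⟩
    exact div_nonneg (mul_pos hμ (E2fun_pos hR₁ hR₁₂ hα hW.1 hW.2)).le (hE1 W hW).le
  · rintro _ ⟨W, hW, rfl⟩
    exact (div_le_iff₀ (hE1 W hW)).2 (hC W hW.1.1)
  · rintro _ ⟨W, hW, rfl⟩
    simp only [ratios]
    rw [← mul_div_assoc]
    exact div_le_div_of_nonneg_right
      (neg_E3fun_le_lamc_mul hR₁ hR₁₂ hμ hg hα hρ' hW.1 hW.2) (hE1 W hW).le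
  · obtain ⟨W, hW, hne, hpos⟩ :=
      exists_admW_neg_E3fun_pos (ξ := ξ) hR₁ hR₁₂ hg hξ hρ' hinst
    exact ⟨_, ⟨W, ⟨hW, hne⟩, rfl⟩, div_pos hpos (hE1 W ⟨hW, hne⟩)⟩

end
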